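/- arXiv:1911.02429 — 2 statements merged into one kernel-verified Lean document; each statement's English description precedes it below -/
import Mathlib

section
/- Let (H, m, u, Δ, ε) be a bialgebra over a commutative ring k such that (H, Δ, ε, u) (with u the unit map of H) is a connected coaugmented cofiltered coalgebra with filtration (H^n)_{n≥0}. Then there exists an antipode S : H → H (a k-linear map with m ∘ (S ⊗ id_H) ∘ Δ = u ∘ ε = m ∘ (id_H ⊗ S) ∘ Δ) satisfying S(1_H) = 1_H and, for every x ∈ ker ε, S(x) = −x − m((S ⊗ id_H)(Δ̄(x))), where Δ̄(x) = Δ(x) − x ⊗ 1_H − 1_H ⊗ x. -/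
open TensorProduct

/-- The image of `P ⊗ Q` in `H ⊗ H`, for submodules `P Q : Submodule k H`. -/
noncomputable def tensorImage {k H : Type*} [CommRing k] [AddCommGroup H] [Module k H]
    (P Q : Submodule k H) : Submodule k (H ⊗[k] H) :=
  LinearMap.range (TensorProduct.map P.subtype Q.subtype)

open LinearMap WithConv in
/-- A convolution product vanishes at `x` as soon as the pointwise products vanish on every
piece `P ⊗ Q` of the filtration of `C ⊗ C` in which `Δ x` lies. -/
theorem LinearMap.convMul_apply_eq_zero_of_comul_mem {k C A : Type*} [CommRing k]
    [AddCommGroup C] [Module k C] [Coalgebra k C] [Ring A] [Algebra k A]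
    {F : ℕ → Submodule k C} {n : ℕ} {x : C}
    (hx : Coalgebra.comul x ∈ ⨆ (p : ℕ) (q : ℕ) (_ : p + q = n), tensorImage (F p) (F q))
    {g h : WithConv (C →ₗ[k] A)}
    (hgh : ∀ p q, p + q = n → ∀ a ∈ F p, ∀ b ∈ F q, g a * h b = 0) :
    (g * h) x = 0 := by
  have hle : (⨆ (p : ℕ) (q : ℕ) (_ : p + q = n), tensorImage (F p) (F q)) ≤
      ker (mul' k A ∘ₗ TensorProduct.map g.ofConv h.ofConv) := by
    refine iSup_le fun p => iSup_le fun q => iSup_le fun hpq => ?_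
    rw [tensorImage, range_le_ker_iff]
    ext a b
    simpa using hgh p q hpq a a.2 b b.2
  exact hle hx

open LinearMap WithConv in
/-- In a cofiltered coalgebra, a linear map vanishing on `F 0` is locally nilpotent for the
convolution product. -/
theorem LinearMap.convPow_apply_eq_zero {k C A : Type*} [CommRing k]
    [AddCommGroup C] [Module k C] [Coalgebra k C] [Ring A] [Algebra k A]
    {F : ℕ → Submodule k C}
    (hcomul : ∀ n, ∀ x ∈ F n, Coalgebra.comul x ∈
      ⨆ (p : ℕ) (q : ℕ) (_ : p + q = n), tensorImage (F p) (F q))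
    {f : WithConv (C →ₗ[k] A)} (hf : ∀ x ∈ F 0, f x = 0) {m n : ℕ} (hmn : n < m)
    {x : C} (hx : x ∈ F n) : (f ^ m) x = 0 := by
  induction m generalizing n x with
  | zero => omega
  | succ m ih =>
    rw [pow_succ']
    refine convMul_apply_eq_zero_of_comul_mem (hcomul n x hx) fun p q hpq a ha b hb => ?_
    obtain rfl | hp := Nat.eq_zero_or_pos p
    · rw [hf a ha, zero_mul]
    · rw [ih (by omega) hb, mul_zero]

open LinearMap WithConv in
/-- In an exhaustively cofiltered coalgebra, `1 - f` is invertible for the convolution product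
whenever `f` vanishes on `F 0`. -/
theorem LinearMap.exists_convMul_one_sub_eq_one {k C A : Type*} [CommRing k]
    [AddCommGroup C] [Module k C] [Coalgebra k C] [Ring A] [Algebra k A]
    {F : ℕ → Submodule k C} (hexh : ∀ x : C, ∃ n, x ∈ F n) (hmono : Monotone F)
    (hcomul : ∀ n, ∀ x ∈ F n, Coalgebra.comul x ∈
      ⨆ (p : ℕ) (q : ℕ) (_ : p + q = n), tensorImage (F p) (F q))
    {f : WithConv (C →ₗ[k] A)} (hf : ∀ x ∈ F 0, f x = 0) :
    ∃ g : WithConv (C →ₗ[k] A), g * (1 - f) = 1 ∧ (1 - f) * g = 1 := by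
  have hpow {m n : ℕ} (hmn : n < m) {x : C} (hx : x ∈ F n) : (f ^ m) x = 0 :=
    convPow_apply_eq_zero hcomul hf hmn hx
  have hsub {n : ℕ} {x : C} (hx : x ∈ F n) :
      (Function.support fun i => (f ^ i) x) ⊆ Finset.range (n + 1) := by
    intro i hi
    by_contra hin
    exact hi (hpow (by simpa using hin) hx)
  have hfin (x : C) : (Function.support fun i => (f ^ i) x).Finite :=
    (hexh x).elim fun n hx => (Finset.finite_toSet _).subset (hsub hx)
  let g : WithConv (C →ₗ[k] A) := toConv
    { toFun := fun x => ∑ᶠ i, (f ^ i) x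
      map_add' := fun x y => by
        simp only [map_add]
        exact finsum_add_distrib (hfin x) (hfin y)
      map_smul' := fun c x => by
        simp only [map_smul, RingHom.id_apply]
        exact (smul_finsum' c (hfin x)).symm }
  have hg {p n : ℕ} (hpn : p ≤ n) {a : C} (ha : a ∈ F p) :
      (g - ∑ i ∈ Finset.range (n + 1), f ^ i) a = 0 := by
    have h : g a = ∑ i ∈ Finset.range (n + 1), (f ^ i) a :=
      finsum_eq_sum_of_support_subset _ (hsub (hmono hpn ha))
    simp only [ofConv_sub, ofConv_sum, LinearMap.sub_apply, LinearMap.sum_apply, h, sub_self]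
  refine ⟨g, ?_, ?_⟩ <;> ext x <;> obtain ⟨n, hx⟩ := hexh x
  · have h : ((g - ∑ i ∈ Finset.range (n + 1), f ^ i) * (1 - f)) x = 0 :=
      convMul_apply_eq_zero_of_comul_mem (hcomul n x hx) fun p q hpq a ha b _ => by
        rw [hg (by omega) ha, zero_mul]
    rw [sub_mul, geom_sum_mul_neg, ofConv_sub, LinearMap.sub_apply, ofConv_sub,
      LinearMap.sub_apply, hpow n.lt_succ_self hx, sub_zero] at h
    exact sub_eq_zero.mp h
  · have h : ((1 - f) * (g - ∑ i ∈ Finset.range (n + 1), f ^ i)) x = 0 :=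
      convMul_apply_eq_zero_of_comul_mem (hcomul n x hx) fun p q hpq a _ b hb => by
        rw [hg (by omega) hb, mul_zero]
    rw [mul_sub, mul_neg_geom_sum, ofConv_sub, LinearMap.sub_apply, ofConv_sub,
      LinearMap.sub_apply, hpow n.lt_succ_self hx, sub_zero] at h
    exact sub_eq_zero.mp h

/-- Let `(H, m, u, Δ, ε)` be a bialgebra over a commutative ring `k` whose
underlying coaugmented coalgebra (with coaugmentation the unit map `u`) is connected
cofiltered via `(Hⁿ)ₙ`. Then there is an antipode `S : H → H` (a `k`-linear map with
`m ∘ (S ⊗ id) ∘ Δ = u ∘ ε = m ∘ (id ⊗ S) ∘ Δ`) satisfying `S(1) = 1` and, for every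
`x ∈ ker ε`, the recursion `S(x) = -x - m((S ⊗ id)(Δ̄(x)))`, where
`Δ̄(x) = Δ(x) - x ⊗ 1 - 1 ⊗ x`. -/
theorem antipode_left_recursion_of_connected_cofiltered_bialgebra
    {k H : Type*} [CommRing k] [Ring H] [Bialgebra k H]
    (F : ℕ → Submodule k H)
    (hexh : ∀ x : H, ∃ n, x ∈ F n)
    (hmono : ∀ n, F n ≤ F (n + 1))
    (hcomul : ∀ n, ∀ x ∈ F n, Coalgebra.comul x ∈
      ⨆ (p : ℕ) (q : ℕ) (_ : p + q = n), tensorImage (F p) (F q))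
    (hsplit : ∀ n, F n = LinearMap.range (Algebra.linearMap k H) ⊔
      (F n ⊓ LinearMap.ker (Coalgebra.counit (R := k) (A := H))))
    (hconn : F 0 = LinearMap.range (Algebra.linearMap k H)) :
    ∃ S : H →ₗ[k] H,
      (LinearMap.mul' k H ∘ₗ TensorProduct.map S LinearMap.id ∘ₗ Coalgebra.comul
        = Algebra.linearMap k H ∘ₗ Coalgebra.counit) ∧
      (LinearMap.mul' k H ∘ₗ TensorProduct.map LinearMap.id S ∘ₗ Coalgebra.comul
        = Algebra.linearMap k H ∘ₗ Coalgebra.counit) ∧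
      S 1 = 1 ∧
      (∀ x ∈ LinearMap.ker (Coalgebra.counit (R := k) (A := H)),
        S x = -x - LinearMap.mul' k H (TensorProduct.map S LinearMap.id
          (Coalgebra.comul x - x ⊗ₜ[k] (1 : H) - (1 : H) ⊗ₜ[k] x))) := by
  have hf : ∀ x ∈ F 0, (1 - WithConv.toConv LinearMap.id : WithConv (H →ₗ[k] H)) x = 0 := by
    rw [hconn]
    rintro _ ⟨c, rfl⟩
    simp [LinearMap.convOne_def, WithConv.ofConv_sub]
  obtain ⟨g, hleft, hright⟩ := LinearMap.exists_convMul_one_sub_eq_one hexh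
    (monotone_nat_of_le_succ hmono) hcomul hf
  rw [sub_sub_cancel] at hleft hright
  have hS (x : H) : LinearMap.mul' k H (TensorProduct.map g.ofConv LinearMap.id
      (Coalgebra.comul x)) = algebraMap k H (Coalgebra.counit x) :=
    congrArg (fun φ : WithConv (H →ₗ[k] H) => φ x) hleft
  have hone : g.ofConv 1 = 1 := by
    simpa [Algebra.TensorProduct.one_def] using hS 1
  refine ⟨g.ofConv, congrArg WithConv.ofConv hleft, congrArg WithConv.ofConv hright, hone, ?_⟩
  intro x hx
  rw [LinearMap.mem_ker] at hx
  simp only [map_sub, hS, hx, map_zero, TensorProduct.map_tmul, LinearMap.mul'_apply,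
    LinearMap.id_apply, hone, mul_one, one_mul]
  abel
end

section
/- Let (H, m, u, Δ, ε) be a bialgebra over a commutative ring k such that (H, Δ, ε, u) (with u the unit map of H) is a connected coaugmented cofiltered coalgebra with filtration (H^n)_{n≥0}. Then there exists an antipode S : H → H (a k-linear map with m ∘ (S ⊗ id_H) ∘ Δ = u ∘ ε = m ∘ (id_H ⊗ S) ∘ Δ) satisfying S(1_H) = 1_H and, for every x ∈ ker ε, S(x) = −x − m((id_H ⊗ S)(Δ̄(x))), where Δ̄(x) = Δ(x) − x ⊗ 1_H − 1_H ⊗ x. -/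
open TensorProduct

section

open WithConv

variable {k H : Type*} [CommRing k] [Ring H] [Bialgebra k H]

/-- Two convolution products agree on `F n` as soon as they agree on all products of elements of
`F p` and `F q` with `p + q = n`. -/
lemma convMul_apply_congr_of_mem (F : ℕ → Submodule k H) {n : ℕ} {x : H}
    (hx : Coalgebra.comul x ∈ ⨆ (p : ℕ) (q : ℕ) (_ : p + q = n), tensorImage (F p) (F q))
    {f g f' g' : WithConv (H →ₗ[k] H)}
    (h : ∀ p q, p + q = n → ∀ a ∈ F p, ∀ b ∈ F q, f a * g b = f' a * g' b) :
    (f * g) x = (f' * g') x := by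
  rw [LinearMap.convMul_apply, LinearMap.convMul_apply]
  suffices hle : (⨆ (p : ℕ) (q : ℕ) (_ : p + q = n), tensorImage (F p) (F q)) ≤
      LinearMap.eqLocus (LinearMap.mul' k H ∘ₗ TensorProduct.map f.ofConv g.ofConv)
        (LinearMap.mul' k H ∘ₗ TensorProduct.map f'.ofConv g'.ofConv) from hle hx
  refine iSup_le fun p => iSup_le fun q => iSup_le fun hpq => ?_
  rintro _ ⟨t, rfl⟩
  rw [LinearMap.mem_eqLocus]
  induction t with
  | zero => simp
  | add s t hs ht => simp only [map_add, hs, ht]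
  | tmul a b => simpa using h p q hpq a a.2 b b.2

/-- A convolution power `f ^ m` vanishes on `F n` for `n < m` if `f` vanishes on `F 0`. -/
lemma convPow_apply_eq_zero_of_mem (F : ℕ → Submodule k H)
    (hcomul : ∀ n, ∀ x ∈ F n, Coalgebra.comul x ∈
      ⨆ (p : ℕ) (q : ℕ) (_ : p + q = n), tensorImage (F p) (F q))
    {f : WithConv (H →ₗ[k] H)} (hf : ∀ x ∈ F 0, f x = 0) {m n : ℕ} (hnm : n < m)
    {x : H} (hx : x ∈ F n) : (f ^ m) x = 0 := by
  induction m generalizing n x with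
  | zero => omega
  | succ m ih =>
    rw [pow_succ', convMul_apply_congr_of_mem F (hcomul n x hx) (f' := 0) (g' := 0), mul_zero]
    · rfl
    · intro p q hpq a ha b hb
      have h0 : (0 : WithConv (H →ₗ[k] H)) a * (0 : WithConv (H →ₗ[k] H)) b = 0 := mul_zero _
      rw [h0]
      rcases p.eq_zero_or_pos with rfl | hp
      · rw [hf a ha, zero_mul]
      · rw [ih (by omega) hb, mul_zero]

/-- A family of linear maps that is eventually constant on each step of an exhaustive increasing
filtration has a linear limit. -/
lemma exists_linearMap_eq_on_filtration {k M N : Type*} [CommRing k] [AddCommGroup M] [Module k M]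
    [AddCommGroup N] [Module k N] (F : ℕ → Submodule k M) (hF : Monotone F)
    (hexh : ∀ x, ∃ n, x ∈ F n) (T : ℕ → M →ₗ[k] N)
    (hT : ∀ n, ∀ x ∈ F n, ∀ m, n ≤ m → T m x = T n x) :
    ∃ S : M →ₗ[k] N, ∀ n, ∀ x ∈ F n, S x = T n x := by
  choose d hd using hexh
  have key : ∀ n, ∀ x ∈ F n, T (d x) x = T n x := fun n x hx =>
    (le_total n (d x)).elim (hT n x hx _) fun h => (hT _ x (hd x) _ h).symm
  refine ⟨{ toFun := fun x => T (d x) x, map_add' := fun x y => ?_, map_smul' := fun c x => ?_ },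
    key⟩
  · have hx := hF (le_max_left (d x) (d y)) (hd x)
    have hy := hF (le_max_right (d x) (d y)) (hd y)
    rw [key _ _ (add_mem hx hy), key _ _ hx, key _ _ hy, map_add]
  · rw [key _ _ ((F (d x)).smul_mem c (hd x)), map_smul, RingHom.id_apply]

/-- The identity is convolution invertible on a connected cofiltered bialgebra. -/
lemma exists_convInverse_id (F : ℕ → Submodule k H) (hexh : ∀ x : H, ∃ n, x ∈ F n)
    (hF : Monotone F)
    (hcomul : ∀ n, ∀ x ∈ F n, Coalgebra.comul x ∈
      ⨆ (p : ℕ) (q : ℕ) (_ : p + q = n), tensorImage (F p) (F q))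
    (hconn : F 0 = LinearMap.range (Algebra.linearMap k H)) :
    ∃ S : WithConv (H →ₗ[k] H), S * toConv LinearMap.id = 1 ∧ toConv LinearMap.id * S = 1 := by
  set f : WithConv (H →ₗ[k] H) := 1 - toConv LinearMap.id with hf
  have hid : toConv LinearMap.id = 1 - f := by rw [hf, sub_sub_cancel]
  have hf0 : ∀ x ∈ F 0, f x = 0 := by
    rw [hconn]
    rintro _ ⟨c, rfl⟩
    change (1 : WithConv (H →ₗ[k] H)) _ - LinearMap.id _ = 0
    simp
  have hpow {m n : ℕ} (h : n < m) {x : H} (hx : x ∈ F n) : (f ^ m) x = 0 :=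
    convPow_apply_eq_zero_of_mem F hcomul hf0 h hx
  let P : ℕ → WithConv (H →ₗ[k] H) := fun n => ∑ i ∈ Finset.range (n + 1), f ^ i
  obtain ⟨S, hS⟩ := exists_linearMap_eq_on_filtration F hF hexh (fun n => (P n).ofConv) (by
    intro n x hx m hnm
    induction m, hnm using Nat.le_induction with
    | base => rfl
    | succ m hnm ih =>
      have : P (m + 1) = P m + f ^ (m + 1) := Finset.sum_range_succ _ _
      rw [this, ← ih]
      change P m x + (f ^ (m + 1)) x = P m x
      rw [hpow (by omega) hx, add_zero])
  have hSP : ∀ n p, p ≤ n → ∀ a ∈ F p, toConv S a = P n a := fun n p hp a ha =>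
    hS n a (hF hp ha)
  have hone : ∀ n, ∀ x ∈ F n, (1 - f ^ (n + 1)) x = (1 : WithConv (H →ₗ[k] H)) x := by
    intro n x hx
    change (1 : WithConv (H →ₗ[k] H)) x - (f ^ (n + 1)) x = _
    rw [hpow (by omega) hx, sub_zero]
  refine ⟨toConv S, ?_, ?_⟩
  · ext x
    obtain ⟨n, hx⟩ := hexh x
    change (toConv S * toConv LinearMap.id : WithConv (H →ₗ[k] H)) x = (1 : WithConv (H →ₗ[k] H)) x
    rw [convMul_apply_congr_of_mem F (hcomul n x hx) (f' := P n) (g' := 1 - f), geom_sum_mul_neg,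
      hone n x hx]
    intro p q hpq a ha b _
    rw [hSP n p (by omega) a ha, hid]
  · ext x
    obtain ⟨n, hx⟩ := hexh x
    change (toConv LinearMap.id * toConv S : WithConv (H →ₗ[k] H)) x = (1 : WithConv (H →ₗ[k] H)) x
    rw [convMul_apply_congr_of_mem F (hcomul n x hx) (f' := 1 - f) (g' := P n), mul_neg_geom_sum,
      hone n x hx]
    intro p q hpq a _ b hb
    rw [hSP n q (by omega) b hb, hid]

end

/-- Let `(H, m, u, Δ, ε)` be a bialgebra over a commutative ring `k` whose
underlying coaugmented coalgebra (with coaugmentation the unit map `u`) is connected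
cofiltered via `(Hⁿ)ₙ`. Then there is an antipode `S : H → H` (a `k`-linear map with
`m ∘ (S ⊗ id) ∘ Δ = u ∘ ε = m ∘ (id ⊗ S) ∘ Δ`) satisfying `S(1) = 1` and, for every
`x ∈ ker ε`, the recursion `S(x) = -x - m((id ⊗ S)(Δ̄(x)))`, where
`Δ̄(x) = Δ(x) - x ⊗ 1 - 1 ⊗ x`. -/
theorem antipode_right_recursion_of_connected_cofiltered_bialgebra
    {k H : Type*} [CommRing k] [Ring H] [Bialgebra k H]
    (F : ℕ → Submodule k H)
    (hexh : ∀ x : H, ∃ n, x ∈ F n)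
    (hmono : ∀ n, F n ≤ F (n + 1))
    (hcomul : ∀ n, ∀ x ∈ F n, Coalgebra.comul x ∈
      ⨆ (p : ℕ) (q : ℕ) (_ : p + q = n), tensorImage (F p) (F q))
    (hsplit : ∀ n, F n = LinearMap.range (Algebra.linearMap k H) ⊔
      (F n ⊓ LinearMap.ker (Coalgebra.counit (R := k) (A := H))))
    (hconn : F 0 = LinearMap.range (Algebra.linearMap k H)) :
    ∃ S : H →ₗ[k] H,
      (LinearMap.mul' k H ∘ₗ TensorProduct.map S LinearMap.id ∘ₗ Coalgebra.comul
        = Algebra.linearMap k H ∘ₗ Coalgebra.counit) ∧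
      (LinearMap.mul' k H ∘ₗ TensorProduct.map LinearMap.id S ∘ₗ Coalgebra.comul
        = Algebra.linearMap k H ∘ₗ Coalgebra.counit) ∧
      S 1 = 1 ∧
      (∀ x ∈ LinearMap.ker (Coalgebra.counit (R := k) (A := H)),
        S x = -x - LinearMap.mul' k H (TensorProduct.map LinearMap.id S
          (Coalgebra.comul x - x ⊗ₜ[k] (1 : H) - (1 : H) ⊗ₜ[k] x))) := by
  obtain ⟨S, hl, hr⟩ := exists_convInverse_id F hexh (monotone_nat_of_le_succ hmono) hcomul hconn
  have hr' : LinearMap.mul' k H ∘ₗ TensorProduct.map LinearMap.id S.ofConv ∘ₗ Coalgebra.comul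
      = Algebra.linearMap k H ∘ₗ Coalgebra.counit := congrArg WithConv.ofConv hr
  have h1 : S.ofConv 1 = 1 := by
    simpa [Algebra.TensorProduct.one_def] using LinearMap.congr_fun hr' 1
  refine ⟨S.ofConv, congrArg WithConv.ofConv hl, hr', h1, fun x hx => ?_⟩
  have hxr := LinearMap.congr_fun hr' x
  simp only [LinearMap.comp_apply, LinearMap.mem_ker.mp hx, map_zero] at hxr
  simp [map_sub, hxr, h1]
end
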